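/- Let B, G, R be pairwise disjoint sets of n points each, B ∪ G in general position, with every line through b ∈ B and g ∈ G containing a point of R outside segment [b, g]. Then along the boundary of conv(B ∪ G) blue and green vertices alternate, and B ∪ G is in convex position. -/

import Mathlib

abbrev Pt := Fin 2 → ℝ

def GenPos (S : Set Pt) : Prop :=
  ∀ x ∈ S, ∀ y ∈ S, ∀ z ∈ S, x ≠ y → x ≠ z → y ≠ z → ¬ Collinear ℝ ({x, y, z} : Set Pt)

/-- Signed area determinant of three points (positive iff counterclockwise). -/
def det3 (a b c : Pt) : ℝ :=
  (b 0 - a 0) * (c 1 - a 1) - (b 1 - a 1) * (c 0 - a 0)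


def RayPair (r x y : Pt) : Prop :=
  ∃ t : ℝ, 0 < t ∧ t ≠ 1 ∧ y 0 - r 0 = t * (x 0 - r 0) ∧ y 1 - r 1 = t * (x 1 - r 1)

theorem RayPair.symm {r x y : Pt} (h : RayPair r x y) : RayPair r y x := by
  obtain ⟨t, ht, h1, hx, hy⟩ := h
  refine ⟨t⁻¹, by positivity, by simpa using h1, ?_, ?_⟩
  · rw [hx]; field_simp
  · rw [hy]; field_simp

theorem pt_ext {x y : Pt} (h0 : x 0 = y 0) (h1 : x 1 = y 1) : x = y := by
  ext i; fin_cases i <;> simpa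

theorem collinear_of_det {a b c : Pt} (hab : a ≠ b) (h : det3 a b c = 0) :
    Collinear ℝ ({a, b, c} : Set Pt) := by
  rw [collinear_iff_of_mem (p₀ := a) (by simp)]
  refine ⟨b - a, ?_⟩
  unfold det3 at h
  intro p hp
  simp only [Set.mem_insert_iff, Set.mem_singleton_iff] at hp
  rcases hp with rfl | rfl | rfl
  · exact ⟨0, by simp⟩
  · exact ⟨1, by simp⟩
  · by_cases h0 : b 0 - a 0 = 0
    · have h1 : b 1 - a 1 ≠ 0 := by
        intro h1
        exact hab (pt_ext (by linarith) (by linarith))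
      refine ⟨(p 1 - a 1) / (b 1 - a 1), pt_ext ?_ ?_⟩
      · have : p 0 - a 0 = 0 := by
          rw [h0] at h
          have : (b 1 - a 1) * (p 0 - a 0) = 0 := by linarith
          exact (mul_eq_zero.1 this).resolve_left h1
        simp [h0]; linarith
      · simp; field_simp; ring
    · refine ⟨(p 0 - a 0) / (b 0 - a 0), pt_ext ?_ ?_⟩
      · simp; field_simp; ring
      · simp; field_simp; linarith

theorem rayPair_of_collinear {b g r : Pt} (hbg : b ≠ g) (hbr : b ≠ r) (hgr : g ≠ r)
    (h : Collinear ℝ ({b, g, r} : Set Pt)) (hs : r ∉ segment ℝ b g) : RayPair r b g := by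
  rw [collinear_iff_of_mem (p₀ := r) (by simp)] at h
  obtain ⟨v, hv⟩ := h
  obtain ⟨s, hs1⟩ := hv b (by simp)
  obtain ⟨t, ht1⟩ := hv g (by simp)
  simp only [vadd_eq_add] at hs1 ht1
  have hs0 : s ≠ 0 := by rintro rfl; simp at hs1; exact hbr hs1
  have ht0 : t ≠ 0 := by rintro rfl; simp at ht1; exact hgr ht1
  refine ⟨t / s, ?_, ?_, ?_, ?_⟩
  · by_contra hneg
    apply hs
    have hlt : t / s < 0 := lt_of_le_of_ne (not_lt.1 hneg) (div_ne_zero ht0 hs0)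
    set q := t / s with hq
    have ht : t = q * s := by rw [hq]; field_simp
    have h1q : 0 < 1 - q := by linarith
    refine ⟨-q / (1 - q), 1 / (1 - q), ?_, by positivity, by field_simp; ring, ?_⟩
    · apply div_nonneg <;> linarith
    · rw [hs1, ht1, ht]
      apply pt_ext <;> simp <;> field_simp <;> ring
  · intro h
    have : t = s := by field_simp at h; exact h
    exact hbg (by rw [hs1, ht1, this])
  · rw [hs1, ht1]; simp; field_simp
  · rw [hs1, ht1]; simp; field_simp

theorem RayPair.det_eq {r x y : Pt} (h : RayPair r x y) : det3 r x y = 0 := by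
  obtain ⟨t, -, -, hx, hy⟩ := h
  unfold det3; rw [hx, hy]; ring

theorem RayPair.ne_left {r x y : Pt} (h : RayPair r x y) (hxy : x ≠ y) : x ≠ r := by
  rintro rfl
  obtain ⟨t, -, -, hx, hy⟩ := h
  exact hxy (pt_ext (by linarith) (by linarith))

theorem RayPair.det3_zero {r x y z : Pt} (h : RayPair r x y) (h' : RayPair r x z) :
    det3 x y z = 0 := by
  obtain ⟨t, -, -, hx, hy⟩ := h
  obtain ⟨t', -, -, hx', hy'⟩ := h'
  have e1 : y 0 = r 0 + t * (x 0 - r 0) := by linarith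
  have e2 : y 1 = r 1 + t * (x 1 - r 1) := by linarith
  have e3 : z 0 = r 0 + t' * (x 0 - r 0) := by linarith
  have e4 : z 1 = r 1 + t' * (x 1 - r 1) := by linarith
  unfold det3; rw [e1, e2, e3, e4]; ring

structure Cfg (B G R : Finset Pt) : Prop where
  gp : ∀ x ∈ B ∪ G, ∀ y ∈ B ∪ G, ∀ z ∈ B ∪ G, x ≠ y → x ≠ z → y ≠ z → det3 x y z ≠ 0
  part : ∀ b ∈ B, ∀ r ∈ R, ∃ g ∈ G, RayPair r b g
  part' : ∀ g ∈ G, ∀ r ∈ R, ∃ b ∈ B, RayPair r g b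
  pierce : ∀ b ∈ B, ∀ g ∈ G, ∃ r ∈ R, RayPair r b g
  uniq : ∀ b ∈ B, ∀ g ∈ G, ∀ r ∈ R, ∀ r' ∈ R, RayPair r b g → RayPair r' b g → r = r'
  disj : ∀ b ∈ B, ∀ g ∈ G, b ≠ g
  cB : B.card = R.card
  cG : G.card = R.card

theorem Cfg.swap {B G R : Finset Pt} (h : Cfg B G R) : Cfg G B R where
  gp := by rw [Finset.union_comm]; exact h.gp
  part := h.part'
  part' := h.part
  pierce := fun g hg b hb => by
    obtain ⟨r, hr, h1⟩ := h.pierce b hb g hg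
    exact ⟨r, hr, h1.symm⟩
  uniq := fun g hg b hb r hr r' hr' h1 h2 => h.uniq b hb g hg r hr r' hr' h1.symm h2.symm
  disj := fun g hg b hb => (h.disj b hb g hg).symm
  cB := h.cG
  cG := h.cB

theorem partner_aux {B G R : Finset Pt}
    (gp : ∀ x ∈ B ∪ G, ∀ y ∈ B ∪ G, ∀ z ∈ B ∪ G, x ≠ y → x ≠ z → y ≠ z → det3 x y z ≠ 0)
    (disj : ∀ b ∈ B, ∀ g ∈ G, b ≠ g)
    (pierce : ∀ b ∈ B, ∀ g ∈ G, ∃ r ∈ R, RayPair r b g) (cG : G.card = R.card)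
    (b : Pt) (hb : b ∈ B) :
    (∀ r ∈ R, ∃ g ∈ G, RayPair r b g) ∧
    (∀ g ∈ G, ∀ r ∈ R, ∀ r' ∈ R, RayPair r b g → RayPair r' b g → r = r') := by
  have key : ∀ g ∈ G, ∀ g' ∈ G, ∀ r, RayPair r b g → RayPair r b g' → g = g' := by
    intro g hg g' hg' r h h'
    by_contra hne
    exact gp b (by simp [hb]) g (by simp [hg]) g' (by simp [hg']) (disj b hb g hg)
      (disj b hb g' hg') hne (h.det3_zero h')
  choose! σ hσ using fun g (hg : g ∈ G) => pierce b hb g hg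
  have hinj : Set.InjOn σ G := by
    intro g hg g' hg' he
    refine key g hg g' hg' (σ g) (hσ g hg).2 ?_
    rw [he]; exact (hσ g' hg').2
  have hsurj := Finset.surj_on_of_inj_on_of_card_le (s := G) (t := R) (fun g _ => σ g)
    (fun g hg => (hσ g hg).1) (fun g g' hg hg' he => hinj hg hg' he) cG.ge
  constructor
  · intro r hr
    obtain ⟨g, hg, rfl⟩ := hsurj r hr
    exact ⟨g, hg, (hσ g hg).2⟩
  · intro g hg r hr r' hr' h h'
    obtain ⟨g1, hg1, rfl⟩ := hsurj r hr
    obtain ⟨g2, hg2, rfl⟩ := hsurj r' hr'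
    rw [key g1 hg1 g hg _ (hσ g1 hg1).2 h, key g2 hg2 g hg _ (hσ g2 hg2).2 h']

theorem cfg_mk {n : ℕ} {B G R : Finset Pt}
    (hB : B.card = n) (hG : G.card = n) (hR : R.card = n)
    (hBG : Disjoint B G) (hBR : Disjoint B R) (hGR : Disjoint G R)
    (hgp : GenPos ↑(B ∪ G))
    (hpierce : ∀ b ∈ B, ∀ g ∈ G, ∃ r ∈ R,
      Collinear ℝ ({b, g, r} : Set Pt) ∧ r ∉ segment ℝ b g) : Cfg B G R := by
  have gp : ∀ x ∈ B ∪ G, ∀ y ∈ B ∪ G, ∀ z ∈ B ∪ G, x ≠ y → x ≠ z → y ≠ z →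
      det3 x y z ≠ 0 := by
    intro x hx y hy z hz h1 h2 h3 h0
    exact hgp x (by simpa using hx) y (by simpa using hy) z (by simpa using hz) h1 h2 h3
      (collinear_of_det h1 h0)
  have disj : ∀ b ∈ B, ∀ g ∈ G, b ≠ g := fun b hb g hg => by
    rintro rfl; exact (Finset.disjoint_left.1 hBG hb hg)
  have pierce : ∀ b ∈ B, ∀ g ∈ G, ∃ r ∈ R, RayPair r b g := by
    intro b hb g hg
    obtain ⟨r, hr, hc, hs⟩ := hpierce b hb g hg
    refine ⟨r, hr, rayPair_of_collinear (disj b hb g hg) ?_ ?_ hc hs⟩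
    · rintro rfl; exact (Finset.disjoint_left.1 hBR hb hr)
    · rintro rfl; exact (Finset.disjoint_left.1 hGR hg hr)
  have pierce' : ∀ g ∈ G, ∀ b ∈ B, ∃ r ∈ R, RayPair r g b := by
    intro g hg b hb
    obtain ⟨r, hr, h1⟩ := pierce b hb g hg
    exact ⟨r, hr, h1.symm⟩
  refine ⟨gp, fun b hb => (partner_aux gp disj pierce (by omega) b hb).1, ?_, pierce,
    fun b hb => (partner_aux gp disj pierce (by omega) b hb).2, disj, by omega, by omega⟩
  exact fun g hg => (partner_aux (by rw [Finset.union_comm]; exact gp)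
    (fun g hg b hb => (disj b hb g hg).symm) pierce' (by omega) g hg).1

def Exposed (S : Finset Pt) (p : Pt) : Prop :=
  ∃ u v : ℝ, ∀ a ∈ S, a ≠ p → u * p 0 + v * p 1 < u * a 0 + v * a 1

def Outer (S : Finset Pt) (r : Pt) : Prop :=
  ∃ u v : ℝ, ∀ a ∈ S, u * r 0 + v * r 1 < u * a 0 + v * a 1

def HEdge (S : Finset Pt) (x y : Pt) : Prop :=
  x ≠ y ∧ ∀ z ∈ S, z ≠ x → z ≠ y → 0 < det3 x y z

theorem key_exists (T : Finset Pt) (p : Pt) (u v : ℝ)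
    (h : ∀ a ∈ T, u * p 0 + v * p 1 < u * a 0 + v * a 1) :
    ∃ κ : Pt → ℝ, ∀ a ∈ T, ∀ b ∈ T, (κ a < κ b ↔ 0 < det3 p a b) := by
  refine ⟨fun a => (u * (a 1 - p 1) - v * (a 0 - p 0)) / (u * (a 0 - p 0) + v * (a 1 - p 1)), ?_⟩
  intro a ha b hb
  have h1 : 0 < u * (a 0 - p 0) + v * (a 1 - p 1) := by linarith [h a ha]
  have h2 : 0 < u * (b 0 - p 0) + v * (b 1 - p 1) := by linarith [h b hb]
  have huv : 0 < u ^ 2 + v ^ 2 := by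
    by_contra hc
    have hu : u = 0 := by nlinarith [sq_nonneg u, sq_nonneg v]
    have hv : v = 0 := by nlinarith [sq_nonneg u, sq_nonneg v]
    simp [hu, hv] at h1
  rw [div_lt_div_iff₀ h1 h2, ← sub_pos]
  have : (u * (b 1 - p 1) - v * (b 0 - p 0)) * (u * (a 0 - p 0) + v * (a 1 - p 1)) -
      (u * (a 1 - p 1) - v * (a 0 - p 0)) * (u * (b 0 - p 0) + v * (b 1 - p 1)) =
      (u ^ 2 + v ^ 2) * det3 p a b := by unfold det3; ring
  rw [this]
  exact mul_pos_iff_of_pos_left huv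

theorem perturb (S : Finset Pt) (φ ψ : Pt → ℝ) :
    ∃ ε : ℝ, 0 < ε ∧ ∀ a ∈ S, 0 < φ a → 0 < φ a + ε * ψ a := by
  induction S using Finset.induction_on with
  | empty => exact ⟨1, one_pos, by simp⟩
  | insert x S hx ih =>
    obtain ⟨ε, he, h⟩ := ih
    by_cases h0 : 0 < φ x
    · have hd : 0 < |ψ x| + 1 := by positivity
      refine ⟨min ε (φ x / (|ψ x| + 1)), lt_min he (by positivity), ?_⟩
      intro a ha hpos
      rcases Finset.mem_insert.1 ha with rfl | ha
      · have hm : min ε (φ a / (|ψ a| + 1)) ≤ φ a / (|ψ a| + 1) := min_le_right _ _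
        have hm0 : 0 < min ε (φ a / (|ψ a| + 1)) := lt_min he (by positivity)
        set m := min ε (φ a / (|ψ a| + 1))
        rw [le_div_iff₀ hd] at hm
        nlinarith [neg_abs_le (ψ a)]
      · have hm : min ε (φ x / (|ψ x| + 1)) ≤ ε := min_le_left _ _
        have hm0 : 0 < min ε (φ x / (|ψ x| + 1)) := lt_min he (by positivity)
        set m := min ε (φ x / (|ψ x| + 1))
        have := h a ha hpos
        rcases le_total 0 (ψ a) with h' | h'
        · positivity
        · nlinarith
    · refine ⟨ε, he, ?_⟩
      intro a ha hpos
      rcases Finset.mem_insert.1 ha with rfl | ha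
      · exact absurd hpos h0
      · exact h a ha hpos

theorem exposed_lex (S : Finset Pt) (p : Pt) (u v u' v' : ℝ)
    (h : ∀ a ∈ S, a ≠ p → u * p 0 + v * p 1 < u * a 0 + v * a 1 ∨
      (u * p 0 + v * p 1 = u * a 0 + v * a 1 ∧ u' * p 0 + v' * p 1 < u' * a 0 + v' * a 1)) :
    Exposed S p := by
  obtain ⟨ε, he, hp⟩ := perturb S (fun a => u * a 0 + v * a 1 - (u * p 0 + v * p 1))
    (fun a => u' * a 0 + v' * a 1 - (u' * p 0 + v' * p 1))
  refine ⟨u + ε * u', v + ε * v', fun a ha hne => ?_⟩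
  rcases h a ha hne with h1 | ⟨h1, h2⟩
  · have := hp a ha (by linarith)
    linarith
  · nlinarith

theorem exists_min_exposed (S : Finset Pt) (hS : S.Nonempty) (u v : ℝ) (huv : u ≠ 0 ∨ v ≠ 0) :
    ∃ p ∈ S, Exposed S p ∧ ∀ a ∈ S, u * p 0 + v * p 1 ≤ u * a 0 + v * a 1 := by
  obtain ⟨q, hq, hqm⟩ := S.exists_min_image (fun a => u * a 0 + v * a 1) hS
  obtain ⟨p, hp, hpm⟩ := (S.filter fun a => u * a 0 + v * a 1 = u * q 0 + v * q 1).exists_min_image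
    (fun a => -v * a 0 + u * a 1) ⟨q, by simp [hq]⟩
  simp only [Finset.mem_filter] at hp hpm
  refine ⟨p, hp.1, exposed_lex S p u v (-v) u ?_, fun a ha => hp.2.trans_le (hqm a ha)⟩
  intro a ha hne
  rcases lt_or_eq_of_le (hp.2.trans_le (hqm a ha)) with h1 | h1
  · exact Or.inl h1
  · refine Or.inr ⟨h1, lt_of_le_of_ne (hpm a ⟨ha, by rw [← h1, hp.2]⟩) fun h2 => hne ?_⟩
    have hpos : u ^ 2 + v ^ 2 ≠ 0 := by
      rcases huv with h | h <;> positivity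
    apply pt_ext
    · apply mul_left_cancel₀ hpos; linear_combination (-u) * h1 + v * h2
    · apply mul_left_cancel₀ hpos; linear_combination (-v) * h1 - u * h2

theorem HEdge.exposed {S : Finset Pt} {x y : Pt} (h : HEdge S x y) : Exposed S y := by
  apply exposed_lex S y (-(y 1 - x 1)) (y 0 - x 0) (x 0 - y 0) (x 1 - y 1)
  intro a ha hne
  by_cases hax : a = x
  · right
    subst hax
    refine ⟨by ring, ?_⟩
    have : 0 < (a 0 - y 0) ^ 2 + (a 1 - y 1) ^ 2 := by
      by_contra hc
      apply h.1
      apply pt_ext <;> nlinarith [sq_nonneg (a 0 - y 0), sq_nonneg (a 1 - y 1)]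
    nlinarith
  · left
    have := h.2 a ha hax hne
    unfold det3 at this
    linarith

theorem det3_swap (a b c : Pt) : det3 a c b = - det3 a b c := by unfold det3; ring

theorem det3_swap' (a b c : Pt) : det3 b a c = - det3 a b c := by unfold det3; ring

theorem det3_ray {r b g : Pt} {t : ℝ} (h0 : g 0 - r 0 = t * (b 0 - r 0))
    (h1 : g 1 - r 1 = t * (b 1 - r 1)) (z : Pt) : det3 b g z = (t - 1) * det3 r b z := by
  have e1 : g 0 = r 0 + t * (b 0 - r 0) := by linarith
  have e2 : g 1 = r 1 + t * (b 1 - r 1) := by linarith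
  unfold det3; rw [e1, e2]; ring

theorem side_lemma {r b g z z' : Pt} (h : RayPair r b g) (h' : RayPair r z z')
    (hz : det3 b g z < 0) : det3 b g z' < 0 := by
  obtain ⟨t, -, -, h0, h1⟩ := h
  obtain ⟨t', ht', -, h0', h1'⟩ := h'
  have e : det3 b g z' = t' * det3 b g z := by
    rw [det3_ray h0 h1, det3_ray h0 h1]
    have : det3 r b z' = t' * det3 r b z := by
      unfold det3; rw [h0', h1']; ring
    rw [this]; ring
  rw [e]; nlinarith

theorem Cfg.next {B G R : Finset Pt} (C : Cfg B G R) {p : Pt} (hp : p ∈ B)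
    (he : Exposed (B ∪ G) p) : ∃ g ∈ G, HEdge (B ∪ G) p g := by
  obtain ⟨u, v, huv⟩ := he
  obtain ⟨κ, hκ⟩ := key_exists ((B ∪ G).erase p) p u v (fun a ha =>
    huv a (Finset.mem_of_mem_erase ha) (Finset.ne_of_mem_erase ha))
  have hGne : G.Nonempty := by
    rw [← Finset.card_pos, C.cG, ← C.cB, Finset.card_pos]; exact ⟨p, hp⟩
  obtain ⟨g, hg, hmin⟩ := G.exists_min_image κ hGne
  have hT : ∀ g ∈ G, g ∈ (B ∪ G).erase p := fun g hg =>
    Finset.mem_erase.2 ⟨(C.disj p hp g hg).symm, by simp [hg]⟩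
  have hGG : ∀ z ∈ G, ¬ det3 p g z < 0 := by
    intro z hz hneg
    have := (hκ z (hT z hz) g (hT g hg)).2 (by rw [det3_swap]; linarith)
    linarith [hmin z hz]
  refine ⟨g, hg, C.disj p hp g hg, fun z hz hzp hzg => ?_⟩
  by_contra hc
  have hne := C.gp p (by simp [hp]) g (by simp [hg]) z hz (C.disj p hp g hg) hzp.symm hzg.symm
  have hneg : det3 p g z < 0 := lt_of_le_of_ne (not_lt.1 hc) hne
  rcases Finset.mem_union.1 hz with hz | hz
  · obtain ⟨r, hr, h1⟩ := C.pierce p hp g hg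
    obtain ⟨g', hg', h2⟩ := C.part z hz r hr
    exact hGG g' hg' (side_lemma h1 h2 hneg)
  · exact hGG z hz hneg

theorem Cfg.partner {B G R : Finset Pt} (C : Cfg B G R) {u r : Pt} (hu : u ∈ B ∪ G)
    (hr : r ∈ R) : ∃ v ∈ B ∪ G, u ≠ v ∧ RayPair r u v := by
  rcases Finset.mem_union.1 hu with hu | hu
  · obtain ⟨g, hg, h⟩ := C.part u hu r hr
    exact ⟨g, by simp [hg], C.disj u hu g hg, h⟩
  · obtain ⟨g, hg, h⟩ := C.part' u hu r hr
    exact ⟨g, by simp [hg], (C.disj g hg u hu).symm, h⟩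

theorem Cfg.uniqB {B G R : Finset Pt} (C : Cfg B G R) {u v r r' : Pt} (hu : u ∈ B)
    (hv : v ∈ B ∪ G) (huv : u ≠ v) (hr : r ∈ R) (hr' : r' ∈ R) (h : RayPair r u v)
    (h' : RayPair r' u v) : r = r' := by
  obtain ⟨g, hg, hgp⟩ := C.part u hu r hr
  have : g = v := by
    by_contra hne
    exact C.gp u (by simp [hu]) g (by simp [hg]) v hv (C.disj u hu g hg) huv hne
      (hgp.det3_zero h)
  subst this
  exact C.uniq u hu g hg r hr r' hr' h h'

theorem Cfg.uniqS {B G R : Finset Pt} (C : Cfg B G R) {u v r r' : Pt} (hu : u ∈ B ∪ G)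
    (hv : v ∈ B ∪ G) (huv : u ≠ v) (hr : r ∈ R) (hr' : r' ∈ R) (h : RayPair r u v)
    (h' : RayPair r' u v) : r = r' := by
  rcases Finset.mem_union.1 hu with hu | hu
  · exact C.uniqB hu hv huv hr hr' h h'
  · exact C.swap.uniqB hu (by rwa [Finset.union_comm]) huv hr hr' h h'

theorem Cfg.tangent {B G R : Finset Pt} (C : Cfg B G R) {u r : Pt} (hu : u ∈ B ∪ G)
    (hr : r ∈ R) (s : ℝ) (hs : s = 1 ∨ s = -1) (h : ∀ z ∈ B ∪ G, 0 ≤ s * det3 r u z) :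
    ∃ x ∈ B ∪ G, ∃ y ∈ B ∪ G, HEdge (B ∪ G) x y ∧ RayPair r x y ∧
      ∀ z ∈ B ∪ G, z ≠ x → z ≠ y → 0 < s * det3 r x z := by
  obtain ⟨v, hv, huv, hR⟩ := C.partner hu hr
  have hR' := hR
  obtain ⟨t, ht, ht1, h0, h1⟩ := hR
  have hpos : ∀ z ∈ B ∪ G, z ≠ u → z ≠ v → 0 < s * det3 r u z := by
    intro z hz h2 h3
    refine lt_of_le_of_ne (h z hz) fun h4 => ?_
    refine C.gp u hu v hv z hz huv h2.symm h3.symm ?_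
    rw [det3_ray h0 h1]
    rcases hs with rfl | rfl
    · rw [show det3 r u z = 0 by linarith]; ring
    · rw [show det3 r u z = 0 by linarith]; ring
  have hv' : ∀ z, det3 r v z = t * det3 r u z := by
    intro z; unfold det3; rw [h0, h1]; ring
  have hcase : 0 < (t - 1) * s ∨ 0 < -((t - 1) * s) := by
    rcases lt_or_gt_of_ne ht1 with h | h <;> rcases hs with rfl | rfl
    · right; linarith
    · left; linarith
    · left; linarith
    · right; linarith
  have hss : s * s = 1 := by rcases hs with rfl | rfl <;> norm_num
  have hd : ∀ z, det3 u v z = ((t - 1) * s) * (s * det3 r u z) := by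
    intro z
    rw [det3_ray h0 h1]; linear_combination (-(t - 1) * det3 r u z) * hss
  rcases hcase with hc | hc
  · refine ⟨u, hu, v, hv, ⟨huv, fun z hz h2 h3 => ?_⟩, hR', hpos⟩
    rw [hd]; exact mul_pos hc (hpos z hz h2 h3)
  · refine ⟨v, hv, u, hu, ⟨huv.symm, fun z hz h2 h3 => ?_⟩, hR'.symm, fun z hz h2 h3 => ?_⟩
    · rw [det3_swap', hd, ← neg_mul]; exact mul_pos hc (hpos z hz h3 h2)
    · rw [hv']
      have := mul_pos ht (hpos z hz h3 h2)
      linarith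

theorem Cfg.two_edges {B G R : Finset Pt} (C : Cfg B G R) {r : Pt} (hr : r ∈ R)
    (ho : Outer (B ∪ G) r) (h3 : 2 < (B ∪ G).card) :
    ∃ e₁ ∈ (B ∪ G) ×ˢ (B ∪ G), ∃ e₂ ∈ (B ∪ G) ×ˢ (B ∪ G), e₁ ≠ e₂ ∧
      (HEdge (B ∪ G) e₁.1 e₁.2 ∧ RayPair r e₁.1 e₁.2) ∧
      (HEdge (B ∪ G) e₂.1 e₂.2 ∧ RayPair r e₂.1 e₂.2) := by
  obtain ⟨u, v, huv⟩ := ho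
  obtain ⟨κ, hκ⟩ := key_exists (B ∪ G) r u v huv
  have hne : (B ∪ G).Nonempty := Finset.card_pos.1 (by omega)
  obtain ⟨m, hm, hmin⟩ := (B ∪ G).exists_min_image κ hne
  obtain ⟨M, hM, hmax⟩ := (B ∪ G).exists_max_image κ hne
  obtain ⟨x, hx, y, hy, hE, hP, hpos⟩ := C.tangent hm hr 1 (Or.inl rfl) (by
    intro z hz
    by_contra hc
    have := (hκ z hz m hm).2 (by rw [det3_swap]; linarith)
    linarith [hmin z hz])
  obtain ⟨x', hx', y', hy', hE', hP', hpos'⟩ := C.tangent hM hr (-1) (Or.inr rfl) (by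
    intro z hz
    by_contra hc
    have := (hκ M hM z hz).2 (by linarith)
    linarith [hmax z hz])
  refine ⟨(x, y), by simp only [Finset.mem_product]; exact ⟨hx, hy⟩, (x', y'),
    by simp only [Finset.mem_product]; exact ⟨hx', hy'⟩, ?_, ⟨hE, hP⟩, hE', hP'⟩
  intro he
  obtain ⟨rfl, rfl⟩ := Prod.mk.inj he
  have : (((B ∪ G).erase x).erase y).Nonempty := by
    rw [← Finset.card_pos]
    have h1 := Finset.pred_card_le_card_erase (s := B ∪ G) (a := x)
    have h2 := Finset.pred_card_le_card_erase (s := (B ∪ G).erase x) (a := y)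
    omega
  obtain ⟨z, hz⟩ := this
  simp only [Finset.mem_erase] at hz
  have h1 := hpos z hz.2.2 hz.2.1 hz.1
  have h2 := hpos' z hz.2.2 hz.2.1 hz.1
  linarith

open Classical in
theorem Cfg.outer_count {B G R : Finset Pt} (C : Cfg B G R) (h3 : 2 < (B ∪ G).card) :
    2 * (R.filter fun r => Outer (B ∪ G) r).card ≤
      ((B ∪ G).filter fun p => Exposed (B ∪ G) p).card := by
  set S := B ∪ G with hS
  set E := (S ×ˢ S).filter fun e => HEdge S e.1 e.2 with hE
  have h1 : (R.filter fun r => Outer S r).card * 2 ≤ E.card * 1 := by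
    apply Finset.card_mul_le_card_mul (fun r (e : Pt × Pt) => RayPair r e.1 e.2)
    · intro r hr
      rw [Finset.mem_filter] at hr
      obtain ⟨e₁, he₁, e₂, he₂, hne, ⟨h1, h2⟩, h3, h4⟩ := C.two_edges hr.1 hr.2 h3
      have : 1 < (E.bipartiteAbove (fun r (e : Pt × Pt) => RayPair r e.1 e.2) r).card := by
        rw [Finset.one_lt_card]
        refine ⟨e₁, ?_, e₂, ?_, hne⟩
        · simp only [Finset.mem_bipartiteAbove, hE, Finset.mem_filter]
          exact ⟨⟨he₁, h1⟩, h2⟩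
        · simp only [Finset.mem_bipartiteAbove, hE, Finset.mem_filter]
          exact ⟨⟨he₂, h3⟩, h4⟩
      exact this
    · intro e he
      rw [Finset.card_le_one]
      intro r hr r' hr'
      simp only [Finset.mem_bipartiteBelow, Finset.mem_filter, hE, Finset.mem_product] at hr hr' he
      exact C.uniqS he.1.1 he.1.2 he.2.1 hr.1.1 hr'.1.1 hr.2 hr'.2
  have h2 : E.card ≤ (S.filter fun p => Exposed S p).card := by
    apply Finset.card_le_card_of_injOn Prod.snd
    · intro e he
      simp only [Finset.coe_filter, hE, Finset.mem_product, Set.mem_ofPred_eq] at he ⊢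
      exact ⟨he.1.2, he.2.exposed⟩
    · rintro ⟨x, y⟩ he ⟨x', y'⟩ he' hyy
      simp only [Finset.coe_filter, hE, Finset.mem_product, Set.mem_ofPred_eq] at he he' hyy
      subst hyy
      by_contra hne
      have hxx : x ≠ x' := fun h => hne (by rw [h])
      have h1 := he.2.2 x' he'.1.1 hxx.symm he'.2.1
      have h2 := he'.2.2 x he.1.1 hxx he.2.1
      have : det3 x' y x = - det3 x y x' := by unfold det3; ring
      linarith
  omega

theorem inner_ray {S : Finset Pt} {p q r : Pt} {t : ℝ} (hq : q ∈ S) (hpq : q ≠ p)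
    (hp : Exposed S p) (hr : ¬ Outer S r)
    (h0 : q 0 - r 0 = t * (p 0 - r 0)) (h1 : q 1 - r 1 = t * (p 1 - r 1)) : t < 1 := by
  obtain ⟨u, v, huv⟩ := hp
  unfold Outer at hr
  push Not at hr
  obtain ⟨a, ha, har⟩ := hr u v
  have hpr : u * p 0 + v * p 1 ≤ u * r 0 + v * r 1 := by
    by_cases hap : a = p
    · rw [← hap]; exact har
    · exact ((huv a ha hap).trans_le har).le
  have hq' := huv q hq hpq
  by_contra hc
  have : u * (q 0 - r 0) + v * (q 1 - r 1) = t * (u * (p 0 - r 0) + v * (p 1 - r 1)) := by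
    rw [h0, h1]; ring
  nlinarith

theorem inner_match {S : Finset Pt} {p q r : Pt} (hpS : p ∈ S) (hq : q ∈ S) (hpq : q ≠ p)
    (hp : Exposed S p) (hr : ¬ Outer S r) (h : RayPair r p q) : ¬ Exposed S q := by
  intro hqe
  have h' := h
  obtain ⟨t, ht, ht1, h0, h1⟩ := h
  have := inner_ray hq hpq hp hr h0 h1
  have h2 := inner_ray (t := t⁻¹) hpS hpq.symm hqe hr (by rw [h0]; field_simp) (by rw [h1]; field_simp)
  have : 1 < t⁻¹ := (one_lt_inv₀ ht).2 this
  linarith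

open Classical in
theorem Cfg.inner_count {B G R : Finset Pt} (C : Cfg B G R) {p : Pt} (hp : p ∈ B)
    (he : Exposed (B ∪ G) p) :
    (R.filter fun r => ¬ Outer (B ∪ G) r).card ≤
      (G.filter fun g => ¬ Exposed (B ∪ G) g).card ∧
    ((G.filter fun g => ¬ Exposed (B ∪ G) g).card ≤
      (R.filter fun r => ¬ Outer (B ∪ G) r).card →
      ∀ g ∈ G, ¬ Exposed (B ∪ G) g → ∃ r ∈ R, ¬ Outer (B ∪ G) r ∧ RayPair r p g) := by
  choose! σ hσ using fun r (hr : r ∈ R) => C.part p hp r hr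
  have hmap : ∀ r ∈ R.filter fun r => ¬ Outer (B ∪ G) r,
      σ r ∈ G.filter fun g => ¬ Exposed (B ∪ G) g := by
    intro r hr
    rw [Finset.mem_filter] at hr ⊢
    obtain ⟨h1, h2⟩ := hσ r hr.1
    exact ⟨h1, inner_match (by simp [hp]) (by simp [h1]) (C.disj p hp _ h1).symm he hr.2 h2⟩
  have hinj : ∀ r r', r ∈ (R.filter fun r => ¬ Outer (B ∪ G) r) →
      r' ∈ (R.filter fun r => ¬ Outer (B ∪ G) r) → σ r = σ r' → r = r' := by
    intro r r' hr hr' hs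
    rw [Finset.mem_filter] at hr hr'
    refine C.uniq p hp (σ r) (hσ r hr.1).1 r hr.1 r' hr'.1 (hσ r hr.1).2 ?_
    rw [hs]; exact (hσ r' hr'.1).2
  refine ⟨Finset.card_le_card_of_injOn σ hmap fun r hr r' hr' => hinj r r' hr hr', ?_⟩
  intro hle g hg hge
  obtain ⟨r, hr, rfl⟩ := Finset.surj_on_of_inj_on_of_card_le (fun r _ => σ r) hmap
    (fun r r' hr hr' => hinj r r' hr hr') hle g (Finset.mem_filter.2 ⟨hg, hge⟩)
  rw [Finset.mem_filter] at hr
  exact ⟨r, hr.1, hr.2, (hσ r hr.1).2⟩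

theorem Cfg.final_aux {B G R : Finset Pt} (C : Cfg B G R)
    (M : ∀ p ∈ B, Exposed (B ∪ G) p → ∀ g ∈ G, ¬ Exposed (B ∪ G) g →
      ∃ r ∈ R, ¬ Outer (B ∪ G) r ∧ RayPair r p g)
    (M' : ∀ p ∈ G, Exposed (B ∪ G) p → ∀ g ∈ B, ¬ Exposed (B ∪ G) g →
      ∃ r ∈ R, ¬ Outer (B ∪ G) r ∧ RayPair r p g)
    {r₀ x y : Pt} (hx : x ∈ B) (hy : y ∈ G)
    (hxe : ¬ Exposed (B ∪ G) x) (hye : ¬ Exposed (B ∪ G) y) (hP : RayPair r₀ x y)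
    (hmin : ∀ z ∈ B ∪ G, ¬ Exposed (B ∪ G) z → 0 ≤ det3 r₀ x z) : False := by
  have hxy := C.disj x hx y hy
  have hxr := hP.ne_left hxy
  have hxS : x ∈ B ∪ G := by simp [hx]
  have hyS : y ∈ B ∪ G := by simp [hy]
  have huv : -(x 1 - r₀ 1) ≠ 0 ∨ x 0 - r₀ 0 ≠ 0 := by
    by_contra hc
    push Not at hc
    exact hxr (pt_ext (by linarith [hc.2]) (by linarith [hc.1]))
  have huv' : (x 1 - r₀ 1) ≠ 0 ∨ -(x 0 - r₀ 0) ≠ 0 := by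
    rcases huv with h | h
    · left; intro h'; exact h (by rw [h']; simp)
    · right; intro h'; exact h (by linarith)
  have haff : ∀ p q r : Pt, ∀ t : ℝ, q 0 - r 0 = t * (p 0 - r 0) → q 1 - r 1 = t * (p 1 - r 1) →
      det3 r₀ x q - det3 r₀ x r = t * (det3 r₀ x p - det3 r₀ x r) := by
    intro p q r t h0 h1
    have e1 : q 0 = r 0 + t * (p 0 - r 0) := by linarith
    have e2 : q 1 = r 1 + t * (p 1 - r 1) := by linarith
    unfold det3; rw [e1, e2]; ring
  have hinner : ∀ r ∈ R, ¬ Outer (B ∪ G) r → 0 ≤ det3 r₀ x r := by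
    intro r hr hro
    by_contra hc
    apply hro
    obtain ⟨p, hp, hpe, hpm⟩ := exists_min_exposed (B ∪ G) ⟨x, hxS⟩ _ _ huv
    refine ⟨_, _, fun a ha => lt_of_lt_of_le ?_ (hpm a ha)⟩
    obtain ⟨q, hq, hpq, hPq⟩ := C.partner hp hr
    have hqe := inner_match hp hq hpq.symm hpe hro hPq
    have h1 := hmin q hq hqe
    obtain ⟨t, ht, -, h2, h3⟩ := hPq
    have h4 := haff p q r t h2 h3
    have : det3 r₀ x r < det3 r₀ x p := by
      by_contra hc'
      nlinarith
    unfold det3 at this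
    linarith
  have hyz : det3 r₀ x y = 0 := hP.det_eq
  have hxz : det3 r₀ x x = 0 := by unfold det3; ring
  have hgen : ∀ p q, p ∈ B ∪ G → q ∈ B ∪ G → q ≠ p → Exposed (B ∪ G) p → ∀ r ∈ R,
      ¬ Outer (B ∪ G) r → RayPair r p q → det3 r₀ x q = 0 → det3 r₀ x p ≤ 0 := by
    intro p q hp hq hqp hpe r hr hro hPr hq0
    obtain ⟨t, ht, -, h2, h3⟩ := hPr
    have h4 := haff p q r t h2 h3
    have h5 := inner_ray hq hqp hpe hro h2 h3
    have h6 := hinner r hr hro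
    by_contra hc
    have h7 : 0 < t * det3 r₀ x p := mul_pos ht (not_le.1 hc)
    nlinarith
  have hhull : ∀ p ∈ B ∪ G, Exposed (B ∪ G) p → det3 r₀ x p ≤ 0 := by
    intro p hp hpe
    rcases Finset.mem_union.1 hp with hpB | hpG
    · obtain ⟨r, hr, hro, hPr⟩ := M p hpB hpe y hy hye
      exact hgen p y hp hyS (C.disj p hpB y hy).symm hpe r hr hro hPr hyz
    · obtain ⟨r, hr, hro, hPr⟩ := M' p hpG hpe x hx hxe
      exact hgen p x hp hxS (C.disj x hx p hpG) hpe r hr hro hPr hxz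
  have hall : ∀ z ∈ B ∪ G, det3 r₀ x z ≤ 0 := by
    intro z hz
    obtain ⟨p, hp, hpe, hpm⟩ := exists_min_exposed (B ∪ G) ⟨x, hxS⟩ _ _ huv'
    have h1 := hpm z hz
    have h2 := hhull p hp hpe
    unfold det3 at h2 ⊢
    linarith
  apply hxe
  apply exposed_lex (B ∪ G) x (x 1 - r₀ 1) (-(x 0 - r₀ 0)) (y 0 - x 0) (y 1 - x 1)
  intro a ha hax
  by_cases hay : a = y
  · right
    subst hay
    refine ⟨?_, ?_⟩
    · unfold det3 at hyz; linarith
    · have : 0 < (a 0 - x 0) ^ 2 + (a 1 - x 1) ^ 2 := by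
        by_contra hc
        apply hxy
        apply pt_ext <;> nlinarith [sq_nonneg (a 0 - x 0), sq_nonneg (a 1 - x 1)]
      nlinarith
  · left
    have hne : det3 r₀ x a ≠ 0 := by
      intro h0
      obtain ⟨t, ht, -, h2, h3⟩ := hP
      apply C.gp x hxS y hyS a ha hxy (Ne.symm hax) (Ne.symm hay)
      rw [det3_ray h2 h3, h0]; ring
    have hlt := lt_of_le_of_ne (hall a ha) hne
    unfold det3 at hlt
    linarith

open Classical in
theorem Cfg.all_exposed {B G R : Finset Pt} (C : Cfg B G R) :
    ∀ q ∈ B ∪ G, Exposed (B ∪ G) q := by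
  intro q hq
  by_contra hqe
  have huc : G ∪ B = B ∪ G := Finset.union_comm _ _
  have hV : (∃ p ∈ B, Exposed (B ∪ G) p) ∧ (∃ p ∈ G, Exposed (B ∪ G) p) := by
    obtain ⟨p, hp, hpe, -⟩ := exists_min_exposed (B ∪ G) ⟨q, hq⟩ 1 0 (by simp)
    rcases Finset.mem_union.1 hp with h | h
    · obtain ⟨g, hg, hE⟩ := C.next h hpe
      exact ⟨⟨p, h, hpe⟩, g, hg, hE.exposed⟩
    · obtain ⟨g, hg, hE⟩ := C.swap.next h (by rwa [huc])
      rw [huc] at hE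
      exact ⟨⟨g, hg, hE.exposed⟩, p, h, hpe⟩
  obtain ⟨⟨pB, hpB, hpBe⟩, pG, hpG, hpGe⟩ := hV
  have h3 : 2 < (B ∪ G).card := by
    rw [Finset.two_lt_card]
    refine ⟨pB, by simp [hpB], pG, by simp [hpG], q, hq, C.disj _ hpB _ hpG, ?_, ?_⟩
    · rintro rfl; exact hqe hpBe
    · rintro rfl; exact hqe hpGe
  have h1 := C.outer_count h3
  obtain ⟨h2, -⟩ := C.inner_count hpB hpBe
  have h4 := C.swap.inner_count hpG (by rwa [huc])
  rw [huc] at h4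
  obtain ⟨h4, -⟩ := h4
  have e1 := Finset.card_filter_add_card_filter_not (s := R) (fun r => Outer (B ∪ G) r)
  have e2 := Finset.card_filter_add_card_filter_not (s := B) (fun r => Exposed (B ∪ G) r)
  have e3 := Finset.card_filter_add_card_filter_not (s := G) (fun r => Exposed (B ∪ G) r)
  have e4 : ((B ∪ G).filter fun p => Exposed (B ∪ G) p).card =
      (B.filter fun p => Exposed (B ∪ G) p).card + (G.filter fun p => Exposed (B ∪ G) p).card := by
    rw [Finset.filter_union, Finset.card_union_of_disjoint]
    apply Finset.disjoint_filter_filter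
    rw [Finset.disjoint_left]
    exact fun a ha hb => C.disj a ha a hb rfl
  have e5 := C.cB
  have e6 := C.cG
  have e7 : 0 < (G.filter fun p => Exposed (B ∪ G) p).card :=
    Finset.card_pos.2 ⟨pG, by simp [hpG, hpGe]⟩
  have M : ∀ p ∈ B, Exposed (B ∪ G) p → ∀ g ∈ G, ¬ Exposed (B ∪ G) g →
      ∃ r ∈ R, ¬ Outer (B ∪ G) r ∧ RayPair r p g := fun p hp hpe =>
    (C.inner_count hp hpe).2 (by omega)
  have M' : ∀ p ∈ G, Exposed (B ∪ G) p → ∀ g ∈ B, ¬ Exposed (B ∪ G) g →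
      ∃ r ∈ R, ¬ Outer (B ∪ G) r ∧ RayPair r p g := by
    intro p hp hpe
    have := C.swap.inner_count hp (by rwa [huc])
    rw [huc] at this
    exact this.2 (by omega)
  have e8 : 0 < (R.filter fun r => Outer (B ∪ G) r).card := by omega
  obtain ⟨r₀, hr₀⟩ := Finset.card_pos.1 e8
  rw [Finset.mem_filter] at hr₀
  obtain ⟨hr₀, ho⟩ := hr₀
  have ho' := ho
  obtain ⟨u, v, huv⟩ := ho'
  obtain ⟨κ, hκ⟩ := key_exists (B ∪ G) r₀ u v huv
  obtain ⟨x, hx, hmin⟩ := ((B ∪ G).filter fun p => ¬ Exposed (B ∪ G) p).exists_min_image κ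
    ⟨q, Finset.mem_filter.2 ⟨hq, hqe⟩⟩
  rw [Finset.mem_filter] at hx
  obtain ⟨hx, hxe⟩ := hx
  have hmin' : ∀ z ∈ B ∪ G, ¬ Exposed (B ∪ G) z → 0 ≤ det3 r₀ x z := by
    intro z hz hze
    by_contra hc
    have := (hκ z hz x hx).2 (by rw [det3_swap]; linarith)
    linarith [hmin z (Finset.mem_filter.2 ⟨hz, hze⟩)]
  rcases Finset.mem_union.1 hx with hxB | hxG
  · obtain ⟨y, hy, hP⟩ := C.part x hxB r₀ hr₀
    refine C.final_aux M M' hxB hy hxe ?_ hP hmin'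
    intro hye
    obtain ⟨r, hr, hro, hPr⟩ := M' y hy hye x hxB hxe
    have := C.uniq x hxB y hy r hr r₀ hr₀ hPr.symm hP
    exact hro (this ▸ ho)
  · obtain ⟨y, hy, hP⟩ := C.part' x hxG r₀ hr₀
    have hye : ¬ Exposed (B ∪ G) y := by
      intro hye
      obtain ⟨r, hr, hro, hPr⟩ := M y hy hye x hxG hxe
      have := C.uniq y hy x hxG r hr r₀ hr₀ hPr hP.symm
      exact hro (this ▸ ho)
    exact C.swap.final_aux (by rw [huc]; exact M') (by rw [huc]; exact M) hxG hy
      (by rwa [huc]) (by rwa [huc]) hP (by rw [huc]; exact hmin')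

theorem not_mem_hull {S : Finset Pt} {p : Pt} (h : Exposed S p) :
    p ∉ convexHull ℝ ((↑S : Set Pt) \ {p}) := by
  obtain ⟨u, v, huv⟩ := h
  intro hp
  have hconv : Convex ℝ {a : Pt | u * p 0 + v * p 1 < u * a 0 + v * a 1} := by
    intro a ha b hb s t hs ht hst
    simp only [Set.mem_ofPred_eq, Pi.add_apply, Pi.smul_apply, smul_eq_mul] at ha hb ⊢
    have : u * p 0 + v * p 1 = s * (u * p 0 + v * p 1) + t * (u * p 0 + v * p 1) := by
      rw [← add_mul, hst, one_mul]
    rcases hs.eq_or_lt with rfl | hs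
    · have : t = 1 := by linarith
      subst this; linarith
    · nlinarith
  have hsub : ((↑S : Set Pt) \ {p}) ⊆ {a : Pt | u * p 0 + v * p 1 < u * a 0 + v * a 1} := by
    intro a ha
    exact huv a (by simpa using ha.1) (by simpa using ha.2)
  have := convexHull_min hsub hconv hp
  simp at this

theorem convex_triple {S : Finset Pt} {p x y z : Pt} (hp : p ∈ S) (hx : x ∈ S) (hz : z ∈ S)
    (hpy : p ≠ y) (hxy : x ≠ y) (hzy : z ≠ y) (hy : Exposed S y) (hne : det3 x y z ≠ 0)
    (h1 : 0 < det3 p x y) (h2 : 0 < det3 p y z) (h3 : 0 < det3 p x z) : 0 < det3 x y z := by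
  obtain ⟨u, v, huv⟩ := hy
  have a1 := huv p hp hpy
  have a2 := huv x hx hxy
  have a3 := huv z hz hzy
  have e1 : det3 x y z = det3 p x y + det3 p y z - det3 p x z := by unfold det3; ring
  have e2 : det3 p x z * ((u * y 0 + v * y 1) - (u * p 0 + v * p 1)) =
      det3 p y z * ((u * x 0 + v * x 1) - (u * p 0 + v * p 1)) +
      det3 p x y * ((u * z 0 + v * z 1) - (u * p 0 + v * p 1)) := by unfold det3; ring
  by_contra hc
  have hlt := lt_of_le_of_ne (not_lt.1 hc) hne
  rw [e1] at hlt
  set X := u * x 0 + v * x 1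
  set Y := u * y 0 + v * y 1
  set Z := u * z 0 + v * z 1
  set P := u * p 0 + v * p 1
  have b1 := mul_pos h2 (sub_pos.2 a2)
  have b2 := mul_pos h1 (sub_pos.2 a3)
  have b3 : 0 < (det3 p x z - det3 p x y - det3 p y z) * (P - Y) :=
    mul_pos (by linarith) (by linarith)
  nlinarith

theorem Cfg.sorted {B G R : Finset Pt} (C : Cfg B G R) {N : ℕ} (hN : (B ∪ G).card = N)
    (hN0 : 0 < N) {p : Pt} (hp : p ∈ B) :
    ∃ X : Fin N → Pt, Function.Injective X ∧ Set.range X = ↑(B ∪ G) ∧ X ⟨0, hN0⟩ = p ∧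
      ∀ i j k, i < j → j < k → 0 < det3 (X i) (X j) (X k) := by
  have hE := C.all_exposed
  have hpS : p ∈ B ∪ G := by simp [hp]
  obtain ⟨u, v, huv⟩ := hE p hpS
  obtain ⟨κ, hκ⟩ := key_exists ((B ∪ G).erase p) p u v (fun a ha =>
    huv a (Finset.mem_of_mem_erase ha) (Finset.ne_of_mem_erase ha))
  obtain ⟨m, hm, hmin⟩ := (B ∪ G).exists_min_image κ ⟨p, hpS⟩
  classical
  set K : Pt → ℝ := fun a => if a = p then κ m - 1 else κ a with hK
  have hKp : ∀ a ∈ B ∪ G, a ≠ p → K p < K a := by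
    intro a ha hap
    simp only [hK, if_true, if_neg hap]
    linarith [hmin a ha]
  have hKinj : Set.InjOn K ↑(B ∪ G) := by
    intro a ha b hb hab
    have ha : a ∈ B ∪ G := ha
    have hb : b ∈ B ∪ G := hb
    by_contra hne
    by_cases hap : a = p
    · subst hap
      exact (hKp b hb (Ne.symm hne)).ne hab
    by_cases hbp : b = p
    · subst hbp
      exact (hKp a ha hne).ne hab.symm
    simp only [hK, if_neg hap, if_neg hbp] at hab
    have h0 := C.gp p hpS a ha b hb (Ne.symm hap) (Ne.symm hbp) hne
    have ha' := Finset.mem_erase.2 ⟨hap, ha⟩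
    have hb' := Finset.mem_erase.2 ⟨hbp, hb⟩
    rcases lt_or_gt_of_ne h0 with h | h
    · have := (hκ b hb' a ha').2 (by rw [det3_swap]; linarith)
      linarith
    · have := (hκ a ha' b hb').2 h
      linarith
  have hcard : ((B ∪ G).image K).card = N := by
    rw [Finset.card_image_of_injOn hKinj, hN]
  set e := ((B ∪ G).image K).orderEmbOfFin hcard with he
  have hmem : ∀ i, ∃ a ∈ B ∪ G, K a = e i := fun i => by
    simpa only [Finset.mem_image] using ((B ∪ G).image K).orderEmbOfFin_mem hcard i
  choose X hXS hXK using hmem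
  have hlt : ∀ i j, i < j → K (X i) < K (X j) := by
    intro i j hij
    rw [hXK, hXK]
    exact e.strictMono hij
  have hinj : Function.Injective X := by
    intro i j hij
    apply e.injective
    rw [← hXK, ← hXK, hij]
  have hsurj : ∀ a ∈ B ∪ G, ∃ i, X i = a := by
    intro a ha
    have : K a ∈ Set.range e := by
      rw [he, Finset.range_orderEmbOfFin]
      exact Finset.mem_coe.2 (Finset.mem_image_of_mem K ha)
    obtain ⟨i, hi⟩ := this
    exact ⟨i, hKinj (hXS i) ha (by rw [hXK, hi])⟩
  have hX0 : X ⟨0, hN0⟩ = p := by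
    obtain ⟨i, hi⟩ := hsurj p hpS
    by_contra hne
    have hi0 : (⟨0, hN0⟩ : Fin N) < i := by
      rw [Fin.lt_def]
      rcases Nat.eq_zero_or_pos i.val with h | h
      · exact absurd (by rw [← hi]; congr 1; exact Fin.ext h.symm) hne
      · exact h
    have h1 := hlt _ _ hi0
    have h2 := hKp _ (hXS ⟨0, hN0⟩) hne
    rw [hi] at h1
    linarith
  have hpos : ∀ i j, X i ≠ p → X j ≠ p → i < j → 0 < det3 p (X i) (X j) := by
    intro i j hi hj hij
    have := hlt i j hij
    simp only [hK, if_neg hi, if_neg hj] at this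
    exact (hκ _ (Finset.mem_erase.2 ⟨hi, hXS i⟩) _ (Finset.mem_erase.2 ⟨hj, hXS j⟩)).1 this
  refine ⟨X, hinj, ?_, hX0, ?_⟩
  · ext a
    constructor
    · rintro ⟨i, rfl⟩; exact hXS i
    · exact fun ha => hsurj a ha
  · intro i j k hij hjk
    have hjp : X j ≠ p := by
      rw [← hX0]; intro h; have := hinj h; subst this; rw [Fin.lt_def] at hij; simp at hij
    have hkp : X k ≠ p := by
      rw [← hX0]; intro h; have := hinj h; subst this; rw [Fin.lt_def] at hjk; simp at hjk
    have hne1 : X i ≠ X j := fun h => hij.ne (hinj h)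
    have hne2 : X j ≠ X k := fun h => hjk.ne (hinj h)
    have hne3 : X i ≠ X k := fun h => (hij.trans hjk).ne (hinj h)
    by_cases hip : X i = p
    · rw [hip]; exact hpos j k hjp hkp hjk
    · exact convex_triple hpS (hXS i) (hXS k) hjp.symm hne1 hne2.symm (hE _ (hXS j))
        (C.gp _ (hXS i) _ (hXS j) _ (hXS k) hne1 hne3 hne2) (hpos i j hip hjp hij)
        (hpos j k hjp hkp hjk) (hpos i k hip hkp (hij.trans hjk))

theorem stmt15 (n : ℕ) (hn : 0 < n) (B G R : Finset Pt)
    (hB : B.card = n) (hG : G.card = n) (hR : R.card = n)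
    (hBG : Disjoint B G) (hBR : Disjoint B R) (hGR : Disjoint G R)
    (hgp : GenPos ↑(B ∪ G))
    (hpierce : ∀ b ∈ B, ∀ g ∈ G, ∃ r ∈ R,
      Collinear ℝ ({b, g, r} : Set Pt) ∧ r ∉ segment ℝ b g) :
    -- (1) B ∪ G is in convex position:
    (∀ p ∈ B ∪ G, p ∉ convexHull ℝ ((↑(B ∪ G) : Set Pt) \ {p})) ∧
    -- (2) in cyclic (counterclockwise) order the colors alternate:
    ∃ x : ZMod (2 * n) → Pt, Function.Injective x ∧ Set.range x = ↑(B ∪ G) ∧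
      (∀ i j : ZMod (2 * n), j ≠ i → j ≠ i + 1 → 0 < det3 (x i) (x (i + 1)) (x j)) ∧
      (∀ i : ZMod (2 * n), if Even i.val then x i ∈ B else x i ∈ G) := by
  have C : Cfg B G R := cfg_mk hB hG hR hBG hBR hGR hgp hpierce
  have hE := C.all_exposed
  refine ⟨fun p hp => not_mem_hull (hE p hp), ?_⟩
  have hN : (B ∪ G).card = 2 * n := by
    rw [Finset.card_union_of_disjoint hBG]; omega
  obtain ⟨p, hp⟩ := Finset.card_pos.1 (by rw [hB]; exact hn : 0 < B.card)
  obtain ⟨X, hinj, hrange, hX0, hpos⟩ := C.sorted hN (by omega) hp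
  have hNe : NeZero (2 * n) := ⟨by omega⟩
  have hval1 : ∀ i : ZMod (2 * n), i.val + 1 < 2 * n → (i + 1).val = i.val + 1 := by
    intro i hi
    have h1 : (1 : ZMod (2 * n)).val = 1 := ZMod.val_one'' (by omega)
    rw [ZMod.val_add_of_lt] <;> rw [h1]
    exact hi
  have hval0 : ∀ i : ZMod (2 * n), ¬ i.val + 1 < 2 * n → (i + 1).val = 0 := by
    intro i hi
    have h1 : (1 : ZMod (2 * n)).val = 1 := ZMod.val_one'' (by omega)
    have h2 := ZMod.val_lt i
    rw [ZMod.val_add, h1, show i.val + 1 = 2 * n by omega, Nat.mod_self]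
  set x : ZMod (2 * n) → Pt := fun i => X ⟨i.val, ZMod.val_lt i⟩ with hx
  have hxinj : Function.Injective x := by
    intro i j hij
    have := hinj hij
    exact ZMod.val_injective _ (Fin.mk.inj this)
  have hxr : Set.range x = ↑(B ∪ G) := by
    rw [← hrange]
    ext a
    constructor
    · rintro ⟨i, rfl⟩; exact ⟨_, rfl⟩
    · rintro ⟨i, rfl⟩
      refine ⟨(i.val : ZMod (2 * n)), ?_⟩
      simp only [hx]
      congr 1
      exact Fin.ext (ZMod.val_cast_of_lt i.isLt)
  have hdet : ∀ i j : ZMod (2 * n), j ≠ i → j ≠ i + 1 → 0 < det3 (x i) (x (i + 1)) (x j) := by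
    intro i j hji hji1
    have hjl := ZMod.val_lt j
    have h1 : j.val ≠ i.val := fun h => hji (ZMod.val_injective _ h)
    have h2 : j.val ≠ (i + 1).val := fun h => hji1 (ZMod.val_injective _ h)
    have cyc : ∀ a b c : Pt, det3 a b c = det3 c a b := by intros; unfold det3; ring
    by_cases hi : i.val + 1 < 2 * n
    · have h3 := hval1 i hi
      rcases lt_or_gt_of_ne h1 with h | h
      · rw [cyc]
        apply hpos <;> rw [Fin.lt_def] <;> simp only <;> omega
      · apply hpos <;> rw [Fin.lt_def] <;> simp only <;> omega
    · have h3 := hval0 i hi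
      rw [← cyc]
      apply hpos <;> rw [Fin.lt_def] <;> simp only <;> omega
  have hmem : ∀ i, x i ∈ B ∪ G := fun i => by
    have : x i ∈ Set.range x := ⟨i, rfl⟩
    rw [hxr] at this
    exact this
  have hi1 : ∀ i : ZMod (2 * n), i + 1 ≠ i := by
    intro i h
    by_cases hi : i.val + 1 < 2 * n
    · have := hval1 i hi; rw [h] at this; omega
    · have := hval0 i hi; rw [h] at this; omega
  have hnext : ∀ (i : ZMod (2 * n)) (g : Pt), g ∈ B ∪ G → HEdge (B ∪ G) (x i) g →
      x (i + 1) = g := by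
    intro i g hg hed
    by_contra hne
    have : g ∈ Set.range x := by rw [hxr]; exact hg
    obtain ⟨j, rfl⟩ := this
    have h1 := hed.2 _ (hmem (i + 1)) (fun h => hi1 i (hxinj h)) hne
    have h2 := hdet i j (fun h => hed.1 (by rw [h])) (fun h => hne (by rw [h]))
    rw [det3_swap] at h1
    linarith
  have hBnext : ∀ i, x i ∈ B → x (i + 1) ∈ G := by
    intro i hi
    obtain ⟨g, hg, hed⟩ := C.next hi (hE _ (hmem i))
    rw [hnext i g (by simp [hg]) hed]; exact hg
  have hGnext : ∀ i, x i ∈ G → x (i + 1) ∈ B := by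
    intro i hi
    have := C.swap.next hi
    rw [Finset.union_comm G B] at this
    obtain ⟨g, hg, hed⟩ := this (hE _ (hmem i))
    rw [hnext i g (by simp [hg]) hed]; exact hg
  have hcol : ∀ k : ℕ, (Even k → x (k : ZMod (2 * n)) ∈ B) ∧
      (¬ Even k → x (k : ZMod (2 * n)) ∈ G) := by
    intro k
    induction k with
    | zero =>
      refine ⟨fun _ => ?_, fun h => absurd (by simp) h⟩
      have : x ((0 : ℕ) : ZMod (2 * n)) = p := by
        rw [← hX0]
        simp only [hx]
        congr 1
        exact Fin.ext (by simp)
      rw [this]; exact hp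
    | succ k ih =>
      rw [Nat.even_add_one, Nat.cast_succ]
      exact ⟨fun h => hGnext _ (ih.2 h), fun h => hBnext _ (ih.1 (not_not.1 h))⟩
  refine ⟨x, hxinj, hxr, hdet, fun i => ?_⟩
  have := hcol i.val
  rw [ZMod.natCast_zmod_val] at this
  split_ifs with h
  · exact this.1 h
  · exact this.2 h
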